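/- arXiv:2605.25789 — 2 statements merged into one kernel-verified Lean document; each statement's English description precedes it below -/
import Mathlib

section
/- Let θ_1 < θ_2 be real numbers, let f : ℝ → ℝ be twice differentiable on an open interval containing [θ_1, θ_2], and suppose there are constants 0 < σ_min² ≤ σ_max² with σ_min² ≤ f''(θ) ≤ σ_max² for every θ ∈ [θ_1, θ_2]. Then ((f'(θ_1) − f'(θ_2))²/2) · (σ_min²/σ_max⁴) ≤ f'(θ_1)·(θ_1 − θ_2) − f(θ_1) + f(θ_2) ≤ ((f'(θ_1) − f'(θ_2))²/2) · (σ_max²/σ_min⁴). -/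
/-- Second-order Taylor formula with Lagrange remainder, assuming only that the second
derivative exists pointwise. -/
theorem exists_taylor_two_lagrange {f f' f'' : ℝ → ℝ} {x y : ℝ} (hxy : x < y)
    (hf : ∀ t ∈ Set.Icc x y, HasDerivAt f (f' t) t)
    (hf' : ∀ t ∈ Set.Icc x y, HasDerivAt f' (f'' t) t) :
    ∃ d ∈ Set.Ioo x y, f y - f x - f' x * (y - x) = f'' d * (y - x) ^ 2 / 2 := by
  have hF : ∀ t ∈ Set.Icc x y,
      HasDerivAt (fun s => f s - f' x * (s - x)) (f' t - f' x) t := fun t ht => by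
    simpa using (hf t ht).fun_sub (((hasDerivAt_id t).sub_const x).const_mul (f' x))
  have hG : ∀ t, HasDerivAt (fun s => (s - x) ^ 2) (2 * (t - x)) t := fun t => by
    simpa using ((hasDerivAt_id t).sub_const x).fun_pow 2
  obtain ⟨c, hc, hceq⟩ := exists_ratio_hasDerivAt_eq_ratio_slope _ _ hxy
    (fun t ht => (hF t ht).continuousAt.continuousWithinAt)
    (fun t ht => hF t (Set.Ioo_subset_Icc_self ht)) _ _
    (fun t _ => (hG t).continuousAt.continuousWithinAt) (fun t _ => hG t)
  have hsub : Set.Icc x c ⊆ Set.Icc x y := Set.Icc_subset_Icc_right hc.2.le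
  obtain ⟨d, hd, hdeq⟩ := exists_hasDerivAt_eq_slope f' f'' hc.1
    (fun t ht => (hf' t (hsub ht)).continuousAt.continuousWithinAt)
    (fun t ht => hf' t (hsub (Set.Ioo_subset_Icc_self ht)))
  refine ⟨d, ⟨hd.1, hd.2.trans hc.2⟩, ?_⟩
  have hcx : 0 < c - x := sub_pos.2 hc.1
  rw [eq_div_iff hcx.ne'] at hdeq
  rw [← hdeq] at hceq
  apply mul_right_cancel₀ hcx.ne'
  linear_combination -hceq / 2

/-- sandwich bounds on the exponential-family KL divergence
`f'(θ₁)(θ₁ − θ₂) − f(θ₁) + f(θ₂)` in terms of the squared mean gap, when the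
second derivative (variance) lies in `[σmin², σmax²]`. -/
theorem stmt_2
    (θ₁ θ₂ : ℝ) (hθ : θ₁ < θ₂)
    (f f' f'' : ℝ → ℝ)
    (a b : ℝ) (ha : a < θ₁) (hb : θ₂ < b)
    (hderiv : ∀ θ ∈ Set.Ioo a b, HasDerivAt f (f' θ) θ)
    (hderiv' : ∀ θ ∈ Set.Ioo a b, HasDerivAt f' (f'' θ) θ)
    (σmin2 σmax2 : ℝ) (hσmin : 0 < σmin2) (hσ : σmin2 ≤ σmax2)
    (hbound : ∀ θ ∈ Set.Icc θ₁ θ₂, σmin2 ≤ f'' θ ∧ f'' θ ≤ σmax2) :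
    ((f' θ₁ - f' θ₂) ^ 2 / 2) * (σmin2 / σmax2 ^ 2)
        ≤ f' θ₁ * (θ₁ - θ₂) - f θ₁ + f θ₂ ∧
      f' θ₁ * (θ₁ - θ₂) - f θ₁ + f θ₂
        ≤ ((f' θ₁ - f' θ₂) ^ 2 / 2) * (σmax2 / σmin2 ^ 2) := by
  have hmem : ∀ t ∈ Set.Icc θ₁ θ₂, t ∈ Set.Ioo a b := fun t ht =>
    ⟨ha.trans_le ht.1, ht.2.trans_lt hb⟩
  obtain ⟨d, hd, hdeq⟩ := exists_taylor_two_lagrange hθ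
    (fun t ht => hderiv t (hmem t ht)) (fun t ht => hderiv' t (hmem t ht))
  obtain ⟨e, he, heq⟩ := exists_hasDerivAt_eq_slope f' f'' hθ
    (fun t ht => (hderiv' t (hmem t ht)).continuousAt.continuousWithinAt)
    (fun t ht => hderiv' t (hmem t (Set.Ioo_subset_Icc_self ht)))
  obtain ⟨hd_min, hd_max⟩ := hbound d (Set.Ioo_subset_Icc_self hd)
  obtain ⟨he_min, he_max⟩ := hbound e (Set.Ioo_subset_Icc_self he)
  have hσmax : 0 < σmax2 := hσmin.trans_le hσ
  have he_pos : 0 < f'' e := hσmin.trans_le he_min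
  rw [eq_div_iff (sub_pos.2 hθ).ne'] at heq
  have hgap : (f' θ₁ - f' θ₂) ^ 2 = f'' e ^ 2 * (θ₂ - θ₁) ^ 2 := by
    rw [← mul_pow, heq]; ring
  have hkl : f' θ₁ * (θ₁ - θ₂) - f θ₁ + f θ₂ = f'' d * (θ₂ - θ₁) ^ 2 / 2 := by
    rw [← hdeq]; ring
  rw [hgap, hkl]
  constructor
  · calc f'' e ^ 2 * (θ₂ - θ₁) ^ 2 / 2 * (σmin2 / σmax2 ^ 2)
        ≤ σmax2 ^ 2 * (θ₂ - θ₁) ^ 2 / 2 * (σmin2 / σmax2 ^ 2) := by gcongr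
      _ = σmin2 * (θ₂ - θ₁) ^ 2 / 2 := by field_simp
      _ ≤ f'' d * (θ₂ - θ₁) ^ 2 / 2 := by gcongr
  · calc f'' d * (θ₂ - θ₁) ^ 2 / 2
        ≤ σmax2 * (θ₂ - θ₁) ^ 2 / 2 := by gcongr
      _ = σmin2 ^ 2 * (θ₂ - θ₁) ^ 2 / 2 * (σmax2 / σmin2 ^ 2) := by field_simp
      _ ≤ f'' e ^ 2 * (θ₂ - θ₁) ^ 2 / 2 * (σmax2 / σmin2 ^ 2) := by gcongr
end

section
/- Let L ≥ 1, let μ, m : {1,…,L} → ℝ, let d > 1, c > 2 be reals and k ∈ ℕ, and suppose |m_j − μ_j| ≤ d^{−k} for every j ∈ {1,…,L}. If an index i satisfies d^{−k} ≤ ((max_j μ_j) − μ_i)/(c + 2), then (max_j m_j) − m_i ≥ c·d^{−k}. -/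
/-- sufficient condition for elimination: if every empirical mean is within
`d^{-k}` of the true mean and the phase resolution satisfies `d^{-k} ≤ Δ_i/(c+2)`, then arm
`i` is empirically eliminated: the empirical best mean exceeds `m i` by at least `c·d^{-k}`. -/
theorem stmt_5
    (L : ℕ) (hL : 1 ≤ L)
    (μ m : ℕ → ℝ)
    (d c : ℝ) (hd : 1 < d) (hc : 2 < c) (k : ℕ)
    (hclose : ∀ j ∈ Finset.Icc 1 L, |m j - μ j| ≤ d ^ (-(k : ℤ)))
    (i : ℕ) (hi : i ∈ Finset.Icc 1 L)
    (hres : d ^ (-(k : ℤ))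
      ≤ ((Finset.Icc 1 L).sup' (Finset.nonempty_Icc.mpr hL) μ - μ i) / (c + 2)) :
    (Finset.Icc 1 L).sup' (Finset.nonempty_Icc.mpr hL) m - m i ≥ c * d ^ (-(k : ℤ)) := by
  obtain ⟨b, hb, hbμ⟩ := Finset.exists_mem_eq_sup' (Finset.nonempty_Icc.mpr hL) μ
  rw [hbμ, le_div_iff₀ (by linarith)] at hres
  have hbm := Finset.le_sup' m hb
  have hb_close := abs_le.mp (hclose b hb)
  have hi_close := abs_le.mp (hclose i hi)
  linarith [hb_close.1, hi_close.2]
end
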